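/- arXiv:2005.04992 — 3 statements merged into one kernel-verified Lean document; each statement's English description precedes it below -/
import Mathlib

section
/- Let N, M ≥ 1, let q ∈ ℂ with 0 < |q| < 1, and let a_1,…,a_N, b_1,…,b_M, c_1,…,c_N ∈ ℂ with c_j ∉ {q^{−n} : n ∈ ℕ} for every j. Let F : {y ∈ ℂ^M : |y_i| < 1 ∀i} → ℂ be defined by F(y) = F_{N,M}({a_j},{b_i};{c_j};{y_i}), and let T_{y_s} be the operator replacing y_s by q y_s. Then for all 1 ≤ r < s ≤ M and every y in the open unit polydisc, [ y_r (1 − b_r T_{y_r})(1 − T_{y_s}) − y_s (1 − b_s T_{y_s})(1 − T_{y_r}) ] F(y) = 0, where y_r, y_s denote multiplication by the corresponding coordinates. -/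
/-- The infinite q-Pochhammer symbol `(a;q)_∞ = ∏_{i=0}^∞ (1 - q^i a)`. -/
noncomputable def qPochInf (q a : ℂ) : ℂ := ∏' i : ℕ, (1 - q ^ i * a)

/-- The q-Pochhammer symbol `(a;q)_n = (a;q)_∞ / (q^n a;q)_∞`. -/
noncomputable def qPochRat (q a : ℂ) (n : ℕ) : ℂ :=
  qPochInf q a / qPochInf q (q ^ n * a)

/-- The generalized q-hypergeometric series `F_{N,M}` as a function of `y`. -/
noncomputable def Fqhyp (q : ℂ) {N M : ℕ} (a : Fin N → ℂ) (b : Fin M → ℂ)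
    (c : Fin N → ℂ) (y : Fin M → ℂ) : ℂ :=
  ∑' m : Fin M → ℕ,
    (∏ j : Fin N, qPochRat q (a j) (∑ i, m i) / qPochRat q (c j) (∑ i, m i)) *
    (∏ i : Fin M, qPochRat q (b i) (m i) / qPochRat q q (m i)) *
    ∏ i : Fin M, y i ^ m i

section qPochhammer

open Filter Topology

variable {q : ℂ}

theorem summable_neg_pow_mul (hq : ‖q‖ < 1) (x : ℂ) :
    Summable fun i : ℕ => ‖-(q ^ i * x)‖ := by
  simpa [norm_mul, norm_pow] using
    (summable_geometric_of_lt_one (norm_nonneg q) hq).mul_right ‖x‖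

theorem multipliable_one_sub_pow_mul (hq : ‖q‖ < 1) (x : ℂ) :
    Multipliable fun i : ℕ => 1 - q ^ i * x := by
  simpa [sub_eq_add_neg] using
    multipliable_one_add_of_summable (summable_neg_pow_mul hq x)

theorem qPochInf_ne_zero (hq : ‖q‖ < 1) {x : ℂ} (hx : ∀ i : ℕ, 1 - q ^ i * x ≠ 0) :
    qPochInf q x ≠ 0 := by
  simpa [qPochInf, sub_eq_add_neg] using
    tprod_one_add_ne_zero_of_summable (f := fun i : ℕ => -(q ^ i * x))
      (fun i => by simpa [sub_eq_add_neg] using hx i) (summable_neg_pow_mul hq x)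

theorem qPochInf_eq_prod_range_mul (hq : ‖q‖ < 1) (x : ℂ) (n : ℕ) :
    qPochInf q x = (∏ i ∈ Finset.range n, (1 - q ^ i * x)) * qPochInf q (q ^ n * x) := by
  have h := Multipliable.prod_mul_tprod_nat_mul' (f := fun i : ℕ => 1 - q ^ i * x) (k := n)
    (by simpa [pow_add, mul_assoc] using multipliable_one_sub_pow_mul hq (q ^ n * x))
  simpa [qPochInf, pow_add, mul_assoc] using h.symm

theorem qPochRat_eq_prod_range (hq : ‖q‖ < 1) {x : ℂ} (hx : qPochInf q x ≠ 0) (n : ℕ) :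
    qPochRat q x n = ∏ i ∈ Finset.range n, (1 - q ^ i * x) := by
  have h := qPochInf_eq_prod_range_mul hq x n
  rw [qPochRat, div_eq_iff (right_ne_zero_of_mul (h ▸ hx))]
  exact h

/-- The recurrence holds for every `x`: if `(x;q)_∞ = 0`, both sides vanish. -/
theorem qPochRat_succ (hq : ‖q‖ < 1) (x : ℂ) (n : ℕ) :
    qPochRat q x (n + 1) = qPochRat q x n * (1 - q ^ n * x) := by
  by_cases hx : qPochInf q x = 0
  · simp [qPochRat, hx]
  · simp [qPochRat_eq_prod_range hq hx, Finset.prod_range_succ]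

theorem tendsto_qPochRat (hq : ‖q‖ < 1) {x : ℂ} (hx : qPochInf q x ≠ 0) :
    Tendsto (qPochRat q x) atTop (𝓝 (qPochInf q x)) := by
  rw [funext (qPochRat_eq_prod_range hq hx)]
  exact (multipliable_one_sub_pow_mul hq x).hasProd.tendsto_prod_nat

theorem exists_norm_le_of_tendsto {u : ℕ → ℂ} {l : ℂ} (h : Tendsto u atTop (𝓝 l)) :
    ∃ C, ∀ n, ‖u n‖ ≤ C := by
  obtain ⟨C, hC⟩ := (Metric.isBounded_range_of_tendsto u h).exists_norm_le
  exact ⟨C, fun n => hC _ ⟨n, rfl⟩⟩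

theorem exists_norm_qPochRat_div_le (hq : ‖q‖ < 1) (x : ℂ) {z : ℂ} (hz : qPochInf q z ≠ 0) :
    ∃ C, ∀ n, ‖qPochRat q x n / qPochRat q z n‖ ≤ C := by
  by_cases hx : qPochInf q x = 0
  · exact ⟨0, by simp [qPochRat, hx]⟩
  · exact exists_norm_le_of_tendsto ((tendsto_qPochRat hq hx).div (tendsto_qPochRat hq hz) hz)

theorem qPochInf_self_ne_zero (hq : ‖q‖ < 1) : qPochInf q q ≠ 0 := by
  refine qPochInf_ne_zero hq fun i h => ?_
  have h1 : ‖q ^ (i + 1)‖ = 1 := by rw [pow_succ, ← sub_eq_zero.1 h, norm_one]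
  rw [norm_pow] at h1
  exact (pow_lt_one₀ (norm_nonneg q) hq i.succ_ne_zero).ne h1

theorem qPochRat_self_ne_zero (hq : ‖q‖ < 1) (n : ℕ) : qPochRat q q n ≠ 0 := by
  have h0 := qPochInf_self_ne_zero hq
  rw [qPochRat_eq_prod_range hq h0]
  exact left_ne_zero_of_mul (qPochInf_eq_prod_range_mul hq q n ▸ h0)

theorem qPochRat_div_succ (hq : ‖q‖ < 1) (b : ℂ) (n : ℕ) :
    qPochRat q b (n + 1) / qPochRat q q (n + 1) * (1 - q ^ (n + 1)) =
      qPochRat q b n / qPochRat q q n * (1 - b * q ^ n) := by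
  have h1 := qPochRat_self_ne_zero hq (n + 1)
  have h0 := qPochRat_self_ne_zero hq n
  rw [qPochRat_succ hq, ← pow_succ] at h1
  rw [qPochRat_succ hq, qPochRat_succ hq q, ← pow_succ]
  have h2 := right_ne_zero_of_mul h1
  field_simp

end qPochhammer

section Multiseries

theorem summable_pi_prod_norm_pow {ι : Type*} [Fintype ι] {y : ι → ℂ} (hy : ∀ i, ‖y i‖ < 1) :
    Summable fun m : ι → ℕ => ∏ i, ‖y i‖ ^ m i := by
  classical
  refine summable_of_sum_le (c := ∏ i, ∑' k : ℕ, ‖y i‖ ^ k)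
    (fun m => Finset.prod_nonneg fun i _ => by positivity) fun u => ?_
  calc ∑ m ∈ u, ∏ i, ‖y i‖ ^ m i
      ≤ ∑ m ∈ Fintype.piFinset fun i => u.image fun m => m i, ∏ i, ‖y i‖ ^ m i := by
        refine Finset.sum_le_sum_of_subset_of_nonneg (fun m hm => ?_)
          fun m _ _ => Finset.prod_nonneg fun i _ => by positivity
        exact Fintype.mem_piFinset.2 fun i => Finset.mem_image_of_mem (fun m => m i) hm
    _ = ∏ i, ∑ k ∈ u.image fun m => m i, ‖y i‖ ^ k := (Finset.prod_univ_sum _ _).symm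
    _ ≤ ∏ i, ∑' k : ℕ, ‖y i‖ ^ k := by
        refine Finset.prod_le_prod (fun i _ => Finset.sum_nonneg fun k _ => by positivity)
          fun i _ => ?_
        exact (summable_geometric_of_lt_one (norm_nonneg _) (hy i)).sum_le_tsum _
          fun k _ => by positivity

theorem prod_update_mul_pow {ι : Type*} [Fintype ι] [DecidableEq ι] (y : ι → ℂ) (q : ℂ) (r : ι)
    (m : ι → ℕ) :
    ∏ i, Function.update y r (q * y r) i ^ m i = q ^ m r * ∏ i, y i ^ m i := by
  have h (i : ι) : Function.update y r (q * y r) i = (if i = r then q else 1) * y i := by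
    by_cases hi : i = r
    · subst hi; simp
    · simp [hi]
  simp only [h, mul_pow, Finset.prod_mul_distrib]
  simp [ite_pow]

theorem prod_add_single_mul {ι : Type*} [Fintype ι] [DecidableEq ι] (g : ι → ℕ → ℂ) (s : ι)
    (n : ι → ℕ) {d e : ℂ} (h : g s (n s + 1) * d = g s (n s) * e) :
    (∏ i, g i ((n + Pi.single s 1 : _ → ℕ) i)) * d = (∏ i, g i (n i)) * e := by
  rw [← Finset.mul_prod_erase _ _ (Finset.mem_univ s),
    ← Finset.mul_prod_erase _ (fun i => g i (n i)) (Finset.mem_univ s)]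
  have h' : ∏ i ∈ Finset.univ.erase s, g i ((n + Pi.single s 1 : _ → ℕ) i) =
      ∏ i ∈ Finset.univ.erase s, g i (n i) :=
    Finset.prod_congr rfl fun i hi => by simp [Finset.ne_of_mem_erase hi]
  rw [h']
  simp only [Pi.add_apply, Pi.single_eq_same]
  rw [mul_right_comm, h, mul_right_comm]

theorem tsum_eq_tsum_add_single {ι : Type*} [DecidableEq ι] (s : ι) {f : (ι → ℕ) → ℂ}
    (hf : ∀ m, m s = 0 → f m = 0) :
    ∑' m, f m = ∑' n : ι → ℕ, f (n + Pi.single s 1) := by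
  refine ((add_left_injective (Pi.single s 1 : ι → ℕ)).tsum_eq fun m hm => ?_).symm
  have hs : m s ≠ 0 := fun h => hm (hf m h)
  refine ⟨m - Pi.single s 1, tsub_add_cancel_of_le fun i => ?_⟩
  by_cases hi : i = s
  · subst hi; simpa using Nat.one_le_iff_ne_zero.2 hs
  · simp [hi]

end Multiseries

section Fqhyp

variable {q : ℂ} {N M : ℕ}

/-- The coefficient of `y ^ m` in the series `Fqhyp q a b c y`. -/
noncomputable def fqhypCoeff (q : ℂ) (a : Fin N → ℂ) (b : Fin M → ℂ) (c : Fin N → ℂ)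
    (m : Fin M → ℕ) : ℂ :=
  (∏ j : Fin N, qPochRat q (a j) (∑ i, m i) / qPochRat q (c j) (∑ i, m i)) *
    ∏ i : Fin M, qPochRat q (b i) (m i) / qPochRat q q (m i)

theorem exists_norm_fqhypCoeff_le (hq : ‖q‖ < 1) (a c : Fin N → ℂ) (b : Fin M → ℂ)
    (hc : ∀ j, qPochInf q (c j) ≠ 0) : ∃ C, ∀ m, ‖fqhypCoeff q a b c m‖ ≤ C := by
  choose A hA using fun j => exists_norm_qPochRat_div_le hq (a j) (hc j)
  choose B hB using fun i => exists_norm_qPochRat_div_le hq (b i) (qPochInf_self_ne_zero hq)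
  refine ⟨(∏ j, A j) * ∏ i, B i, fun m => ?_⟩
  rw [fqhypCoeff, norm_mul, norm_prod, norm_prod]
  gcongr
  · exact Finset.prod_nonneg fun j _ => (norm_nonneg _).trans (hA j 0)
  · exact hA _ _
  · exact hB _ _

theorem summable_fqhypCoeff_mul (hq : ‖q‖ < 1) (a c : Fin N → ℂ) (b : Fin M → ℂ)
    (hc : ∀ j, qPochInf q (c j) ≠ 0) {y : Fin M → ℂ} (hy : ∀ i, ‖y i‖ < 1) :
    Summable fun m => fqhypCoeff q a b c m * ∏ i, y i ^ m i := by
  obtain ⟨C, hC⟩ := exists_norm_fqhypCoeff_le hq a c b hc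
  refine .of_norm_bounded ((summable_pi_prod_norm_pow hy).mul_left C) fun m => ?_
  rw [norm_mul, norm_prod]
  simp only [norm_pow]
  exact mul_le_mul_of_nonneg_right (hC m) (Finset.prod_nonneg fun i _ => by positivity)

theorem hasSum_Fqhyp (hq : ‖q‖ < 1) (a c : Fin N → ℂ) (b : Fin M → ℂ)
    (hc : ∀ j, qPochInf q (c j) ≠ 0) {y : Fin M → ℂ} (hy : ∀ i, ‖y i‖ < 1) :
    HasSum (fun m => fqhypCoeff q a b c m * ∏ i, y i ^ m i) (Fqhyp q a b c y) :=
  (summable_fqhypCoeff_mul hq a c b hc hy).hasSum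

theorem norm_update_mul_lt_one (hq : ‖q‖ < 1) {y : Fin M → ℂ} (hy : ∀ i, ‖y i‖ < 1) (r i : Fin M) :
    ‖Function.update y r (q * y r) i‖ < 1 := by
  by_cases hi : i = r
  · subst hi
    rw [Function.update_self, norm_mul]
    exact mul_lt_one_of_nonneg_of_lt_one_left (norm_nonneg _) hq (hy i).le
  · simpa [hi] using hy i

/-- Multiplying by `y_r`, applying `(1 - b_r T_{y_r}) (1 - T_{y_s})` to the series and shifting the
summation index gives an expression symmetric in `r` and `s`. -/
theorem mul_shift_Fqhyp (hq : ‖q‖ < 1) (a c : Fin N → ℂ) (b : Fin M → ℂ)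
    (hc : ∀ j, qPochInf q (c j) ≠ 0) {r s : Fin M} (hrs : r ≠ s) {y : Fin M → ℂ}
    (hy : ∀ i, ‖y i‖ < 1) :
    y r * (Fqhyp q a b c y
        - b r * Fqhyp q a b c (Function.update y r (q * y r))
        - Fqhyp q a b c (Function.update y s (q * y s))
        + b r * Fqhyp q a b c
            (Function.update (Function.update y s (q * y s)) r (q * y r))) =
      ∑' n : Fin M → ℕ, y r * y s * ((1 - b r * q ^ n r) * (1 - b s * q ^ n s)) *
        ((∏ j : Fin N, qPochRat q (a j) (∑ i, n i + 1) / qPochRat q (c j) (∑ i, n i + 1)) *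
          (∏ i : Fin M, qPochRat q (b i) (n i) / qPochRat q q (n i)) * ∏ i, y i ^ n i) := by
  have hys := norm_update_mul_lt_one hq hy s
  have hr : Function.update y s (q * y s) r = y r := Function.update_of_ne hrs _ _
  have hysr := norm_update_mul_lt_one hq hys r
  have key := ((((hasSum_Fqhyp hq a c b hc hy).sub
    ((hasSum_Fqhyp hq a c b hc (norm_update_mul_lt_one hq hy r)).mul_left (b r))).sub
    (hasSum_Fqhyp hq a c b hc hys)).add
    ((hasSum_Fqhyp hq a c b hc hysr).mul_left (b r))).mul_left (y r)
  simp only [prod_update_mul_pow] at key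
  rw [hr] at key
  rw [← key.tsum_eq, tsum_eq_tsum_add_single s fun m hm => by rw [hm]; ring]
  refine tsum_congr fun n => ?_
  have hn : (n + Pi.single s 1 : _ → ℕ) r = n r := by simp [hrs]
  have hns : (n + Pi.single s 1 : _ → ℕ) s = n s + 1 := by simp
  have hsum : ∑ i, (n + Pi.single s 1 : _ → ℕ) i = ∑ i, n i + 1 := by
    simp [Finset.sum_add_distrib]
  have hB := prod_add_single_mul (fun i k => qPochRat q (b i) k / qPochRat q q k) s n
    (qPochRat_div_succ hq (b s) (n s))
  have hY := prod_add_single_mul (fun i k => y i ^ k) s n (d := 1) (e := y s)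
    (by rw [mul_one, pow_succ])
  rw [mul_one] at hY
  rw [hY, hn, hns, fqhypCoeff, hsum]
  linear_combination (y r * (1 - b r * q ^ n r) *
    (∏ j : Fin N, qPochRat q (a j) (∑ i, n i + 1) / qPochRat q (c j) (∑ i, n i + 1)) *
    ((∏ i, y i ^ n i) * y s)) * hB

end Fqhyp

/-- for `1 ≤ r < s ≤ M`, the q-difference equation
`[ y_r (1 − b_r T_{y_r})(1 − T_{y_s}) − y_s (1 − b_s T_{y_s})(1 − T_{y_r}) ] F = 0`
on the open unit polydisc, with the products of the commuting shift operators
expanded out; `T_{y_s}` replaces `y_s` by `q y_s`. -/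
theorem stmt4 (N M : ℕ) (hN : 1 ≤ N) (hM : 1 ≤ M) (q : ℂ)
    (hq0 : 0 < ‖q‖) (hq1 : ‖q‖ < 1)
    (a c : Fin N → ℂ) (b : Fin M → ℂ)
    (hc : ∀ j : Fin N, ∀ n : ℕ, c j ≠ q ^ (-(n : ℤ)))
    (r s : Fin M) (hrs : r < s)
    (y : Fin M → ℂ) (hy : ∀ i, ‖y i‖ < 1) :
    y r * (Fqhyp q a b c y
        - b r * Fqhyp q a b c (Function.update y r (q * y r))
        - Fqhyp q a b c (Function.update y s (q * y s))
        + b r * Fqhyp q a b c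
            (Function.update (Function.update y s (q * y s)) r (q * y r))) -
    y s * (Fqhyp q a b c y
        - b s * Fqhyp q a b c (Function.update y s (q * y s))
        - Fqhyp q a b c (Function.update y r (q * y r))
        + b s * Fqhyp q a b c
            (Function.update (Function.update y r (q * y r)) s (q * y s))) = 0 := by
  have hc' (j : Fin N) : qPochInf q (c j) ≠ 0 := by
    refine qPochInf_ne_zero hq1 fun n h => hc j n ?_
    have hq : q ^ n ≠ 0 := pow_ne_zero n (norm_pos_iff.1 hq0)
    rw [zpow_neg, zpow_natCast]
    exact eq_inv_of_mul_eq_one_right (sub_eq_zero.1 h).symm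
  rw [mul_shift_Fqhyp hq1 a c b hc' hrs.ne hy, mul_shift_Fqhyp hq1 a c b hc' hrs.ne' hy,
    sub_eq_zero]
  exact tsum_congr fun n => by ring
end

section
/- Let N ≥ 2 and let u_1,…,u_N, v_1,…,v_N ∈ ℂ, with all indices below read modulo N (cyclically). For each j define Q_j = Σ_{a=1}^N (∏_{k=1}^{a−1} u_{j+k}) (∏_{k=a+1}^{N} v_{j+k}), and assume Q_j ≠ 0 for all j. Define u'_j = u_j Q_j/Q_{j−1} and v'_j = v_j Q_{j−1}/Q_j. Then for every z ∈ ℂ, X(u,z)·X(v,z) = X(v',z)·X(u',z), and moreover ∏_{j=1}^N u'_j = ∏_{j=1}^N u_j and ∏_{j=1}^N v'_j = ∏_{j=1}^N v_j (so the determinants of the two factors are preserved and exchanged in order). -/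
/-- The `N×N` matrix `X(u,z) = diag(u_1,…,u_N) + Λ`, where `Λ` has `1` on the
superdiagonal, `z` in the bottom-left corner, and `0` elsewhere. -/
def Xmat (N : ℕ) (u : Fin N → ℂ) (z : ℂ) : Matrix (Fin N) (Fin N) ℂ :=
  Matrix.of fun i j =>
    (if i = j then u i else 0) + (if (i : ℕ) + 1 = (j : ℕ) then 1 else 0) +
    (if (i : ℕ) = N - 1 ∧ (j : ℕ) = 0 then z else 0)

/-- Cyclic (mod `N`) indexing of a vector `u : Fin N → ℂ` by a natural number. -/
def cyc {N : ℕ} (u : Fin N → ℂ) (k : ℕ) : ℂ :=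
  if h : 0 < N then u ⟨k % N, Nat.mod_lt k h⟩ else 0

/-- `Q_j = Σ_{a=1}^N (∏_{k=1}^{a−1} u_{j+k}) (∏_{k=a+1}^{N} v_{j+k})`, with all
indices read cyclically mod `N`.  It is `N`-periodic in `j`. -/
noncomputable def Qplus (N : ℕ) (u v : Fin N → ℂ) (j : ℕ) : ℂ :=
  ∑ a ∈ Finset.Icc 1 N,
    (∏ k ∈ Finset.Ico 1 a, cyc u (j + k)) *
    (∏ k ∈ Finset.Ico (a + 1) (N + 1), cyc v (j + k))

lemma cyc_add_self {N : ℕ} (u : Fin N → ℂ) (k : ℕ) : cyc u (k + N) = cyc u k := by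
  simp [cyc]

lemma cyc_val {N : ℕ} (u : Fin N → ℂ) (i : Fin N) : cyc u i = u i := by
  have h : 0 < N := i.pos
  simp [cyc, h, Nat.mod_eq_of_lt i.isLt]

lemma Qplus_add_self (N : ℕ) (u v : Fin N → ℂ) (j : ℕ) :
    Qplus N u v (j + N) = Qplus N u v j := by
  simp only [Qplus, add_right_comm j N, cyc_add_self]

/-- The product of an `N`-periodic function over a period does not depend on where it starts. -/
lemma prod_period_shift {N : ℕ} {f : ℕ → ℂ} (hf : ∀ k, f (k + N) = f k) (j : ℕ) :
    ∏ k ∈ Finset.range N, f (j + k) = ∏ k ∈ Finset.range N, f k := by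
  induction j with
  | zero => simp
  | succ j ih =>
    rw [← ih]
    cases N with
    | zero => simp
    | succ n =>
      rw [Finset.prod_range_succ, Finset.prod_range_succ' (fun k => f (j + k)),
        show j + 1 + n = j + (n + 1) by ring, hf, add_zero]
      simp only [add_assoc, add_comm 1]

/-- `v_{j+1} Q_j - u_{j+1} Q_{j+1}` telescopes to a quantity independent of `j`. -/
lemma cyc_mul_Qplus_sub (N : ℕ) (u v : Fin N → ℂ) (j : ℕ) :
    cyc v (j + 1) * Qplus N u v j - cyc u (j + 1) * Qplus N u v (j + 1) =
      ∏ k ∈ Finset.range N, cyc v k - ∏ k ∈ Finset.range N, cyc u k := by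
  set T : ℕ → ℂ := fun a => (∏ k ∈ Finset.Ico 1 (a + 1), cyc u (j + k)) *
    ∏ k ∈ Finset.Ico (a + 2) (N + 2), cyc v (j + k) with hT
  have hsum : ∀ i, Qplus N u v i = ∑ a ∈ Finset.range N,
      (∏ k ∈ Finset.Ico 1 (a + 1), cyc u (i + k)) *
        ∏ k ∈ Finset.Ico (a + 2) (N + 1), cyc v (i + k) := by
    intro i
    have h : Finset.Icc 1 N = Finset.Ico 1 (N + 1) := by ext; simp
    rw [Qplus, h, Finset.sum_Ico_eq_sum_range]
    refine Finset.sum_congr (by simp) fun a _ => ?_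
    rw [add_comm 1 a]
  have hv : cyc v (j + 1) * Qplus N u v j = ∑ a ∈ Finset.range N, T a := by
    rw [hsum, Finset.mul_sum]
    refine Finset.sum_congr rfl fun a ha => ?_
    have ha' := Finset.mem_range.1 ha
    rw [hT]
    simp only
    rw [Finset.prod_Ico_succ_top (a := a + 2) (b := N + 1) (by lia),
      show j + (N + 1) = j + 1 + N by ring, cyc_add_self]
    ring
  have hu : cyc u (j + 1) * Qplus N u v (j + 1) = ∑ a ∈ Finset.range N, T (a + 1) := by
    rw [hsum, Finset.mul_sum]
    refine Finset.sum_congr rfl fun a _ => ?_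
    rw [hT]
    simp only
    rw [Finset.prod_eq_prod_Ico_succ_bot (a := 1) (b := a + 1 + 1) (by lia),
      ← Finset.prod_Ico_add' (fun k => cyc u (j + k)) 1 (a + 1) 1,
      ← Finset.prod_Ico_add' (fun k => cyc v (j + k)) (a + 2) (N + 1) 1]
    simp only [add_assoc, add_comm 1, mul_assoc]
  have h0 : T 0 = ∏ k ∈ Finset.range N, cyc v k := by
    rw [← prod_period_shift (cyc_add_self v) (j + 2)]
    simp [hT, Finset.prod_Ico_eq_prod_range, add_assoc]
  have hN : T N = ∏ k ∈ Finset.range N, cyc u k := by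
    rw [← prod_period_shift (cyc_add_self u) (j + 1)]
    simp [hT, Finset.prod_Ico_eq_prod_range, add_assoc]
  rw [hv, hu, ← Finset.sum_sub_distrib, Finset.sum_range_sub', h0, hN]

lemma Xmat_eq_diagonal_add (N : ℕ) (u : Fin N → ℂ) (z : ℂ) :
    Xmat N u z = Matrix.diagonal u + Xmat N 0 z := by
  ext i j
  simp [Xmat, Matrix.diagonal_apply, add_assoc]

/-- Off its support `j ≡ i + 1 (mod N)`, the shift matrix vanishes. -/
lemma Xmat_zero_apply_eq_zero {N : ℕ} {i j : Fin N} {z : ℂ}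
    (h : (j : ℕ) ≠ (i + 1) % N) : Xmat N 0 z i j = 0 := by
  have h1 : ¬ (i : ℕ) + 1 = j := fun e => h (by rw [e, Nat.mod_eq_of_lt j.isLt])
  have h2 : ¬ ((i : ℕ) = N - 1 ∧ (j : ℕ) = 0) := by
    rintro ⟨e, e'⟩
    have : (i : ℕ) + 1 = N := by have := i.isLt; lia
    exact h (by rw [this, e', Nat.mod_self])
  simp [Xmat, h1, h2]

/-- Two products of diagonal-plus-shift matrices agree as soon as their diagonal and
first shifted-diagonal parts do. -/
lemma Xmat_mul_Xmat_congr {N : ℕ} {a b c d : Fin N → ℂ} (z : ℂ)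
    (hdiag : ∀ i, a i * b i = c i * d i)
    (hshift : ∀ i j : Fin N, (j : ℕ) = (i + 1) % N → a i + b j = c i + d j) :
    Xmat N a z * Xmat N b z = Xmat N c z * Xmat N d z := by
  rw [Xmat_eq_diagonal_add N a, Xmat_eq_diagonal_add N b, Xmat_eq_diagonal_add N c,
    Xmat_eq_diagonal_add N d]
  simp only [add_mul, mul_add, Matrix.diagonal_mul_diagonal, hdiag]
  ext i j
  simp only [Matrix.add_apply, Matrix.diagonal_mul, Matrix.mul_diagonal]
  by_cases h : (j : ℕ) = (i + 1) % N
  · linear_combination Xmat N 0 z i j * hshift i j h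
  · simp [Xmat_zero_apply_eq_zero h]

lemma prod_Qplus_pred (N : ℕ) (u v : Fin N → ℂ) :
    ∏ j : Fin N, Qplus N u v ((j : ℕ) + N - 1) = ∏ j : Fin N, Qplus N u v j := by
  rw [Fin.prod_univ_eq_prod_range (fun j => Qplus N u v (j + N - 1)),
    Fin.prod_univ_eq_prod_range (Qplus N u v),
    ← prod_period_shift (Qplus_add_self N u v) (N - 1)]
  refine Finset.prod_congr rfl fun k hk => ?_
  have := Finset.mem_range.1 hk
  congr 1
  lia

/-- the exchange transformation `s^{+,+}`: with
`u'_j = u_j Q_j/Q_{j−1}` and `v'_j = v_j Q_{j−1}/Q_j` (indices mod `N`), one has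
`X(u,z)·X(v,z) = X(v',z)·X(u',z)` for all `z`, and the products of the entries
of each factor are preserved.  (Here `Q_{j-1}` is written `Q_{j+N-1}` using the
`N`-periodicity of `Q`.) -/
theorem stmt6 (N : ℕ) (hN : 2 ≤ N) (u v : Fin N → ℂ)
    (hQ : ∀ j : ℕ, Qplus N u v j ≠ 0)
    (u' v' : Fin N → ℂ)
    (hu' : ∀ j : Fin N, u' j = u j * Qplus N u v j / Qplus N u v ((j : ℕ) + N - 1))
    (hv' : ∀ j : Fin N, v' j = v j * Qplus N u v ((j : ℕ) + N - 1) / Qplus N u v j) :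
    (∀ z : ℂ, Xmat N u z * Xmat N v z = Xmat N v' z * Xmat N u' z) ∧
    (∏ j, u' j) = (∏ j, u j) ∧ (∏ j, v' j) = (∏ j, v j) := by
  have hprod : ∏ j : Fin N, Qplus N u v j ≠ 0 := Finset.prod_ne_zero_iff.2 fun j _ => hQ j
  refine ⟨fun z => Xmat_mul_Xmat_congr z (fun i => ?_) (fun i j hij => ?_), ?_, ?_⟩
  · rw [hu', hv']
    field_simp [hQ]
  · have hcyc (w : Fin N → ℂ) : cyc w (i + 1) = w j := by
      rw [← cyc_val w j, hij]
      simp [cyc]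
    have hper {m n : ℕ} (h : m % N = n % N) : Qplus N u v m = Qplus N u v n := by
      have hp : Function.Periodic (Qplus N u v) N := Qplus_add_self N u v
      rw [← hp.map_mod_nat m, h, hp.map_mod_nat]
    have hj : Qplus N u v j = Qplus N u v (i + 1) := hper (by rw [hij, Nat.mod_mod])
    have hj' : Qplus N u v ((j : ℕ) + N - 1) = Qplus N u v i := by
      refine hper ?_
      rw [Nat.add_sub_assoc (by lia), hij, Nat.mod_add_mod,
        show (i : ℕ) + 1 + (N - 1) = i + N by lia, Nat.add_mod_right]
    have h1 := cyc_mul_Qplus_sub N u v i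
    have h2 := cyc_mul_Qplus_sub N u v (i + N - 1)
    rw [show (i : ℕ) + N - 1 + 1 = i + N by lia, cyc_add_self, cyc_add_self, cyc_val, cyc_val,
      Qplus_add_self] at h2
    rw [hcyc, hcyc] at h1
    rw [hu', hv', hj, hj', ← add_div, eq_div_iff (hQ i)]
    linear_combination h1 - h2
  · simp only [hu', Finset.prod_div_distrib, Finset.prod_mul_distrib, prod_Qplus_pred]
    exact mul_div_cancel_right₀ _ hprod
  · simp only [hv', Finset.prod_div_distrib, Finset.prod_mul_distrib, prod_Qplus_pred]
    exact mul_div_cancel_right₀ _ hprod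
end

section
/- Let N, M ≥ 1, let q ∈ ℂ with 0 < |q| < 1, and let a_1,…,a_M, b_1,…,b_N, x_1,…,x_M ∈ ℂ, γ_1,…,γ_N ∈ ℂ, with b_j ∉ q^ℤ, x_i ∉ q^ℤ, and a_i x_i ∉ q^ℤ for all i, j. Set ν_j = γ_j − γ_{j+1} (with γ_{N+1} = 0). For n ∈ ℤ^N put u_j = q^{n_j} (u_0 = 1, u_j^{ν_j} := exp(ν_j n_j Log q)), and Φ(n) = ∏_{j=1}^N u_j^{ν_j} (q u_j/u_{j−1};q)_∞/(b_j u_j/u_{j−1};q)_∞ · ∏_{i=1}^M (a_i x_i u_N;q)_∞/(x_i u_N;q)_∞, and for 1 ≤ j ≤ N, 1 ≤ i ≤ M put p_{j,i}(n) = (u_{j−1} − b_j u_j)/(1 − a_i x_i u_N) · ∏_{k=1}^{i−1} (1 − x_k u_N)/(1 − a_k x_k u_N). Define Ψ_{j,i}(a⃗,x⃗) = Σ_{n ∈ ℤ^N} Φ(n) p_{j,i}(n), assuming all these families (also after the parameter exchanges below) are absolutely summable. Fix 1 ≤ i ≤ M−1 and let σ_i denote exchanging (a_i, x_i) ↔ (a_{i+1},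 x_{i+1}) in the parameters, and assume x_i − a_{i+1} x_{i+1} ≠ 0. Then: σ_i(Ψ_{j,i}) = [(1 − a_i)x_i/(x_i − a_{i+1}x_{i+1})] Ψ_{j,i} + [(a_i x_i − a_{i+1}x_{i+1})/(x_i − a_{i+1}x_{i+1})] Ψ_{j,i+1}; σ_i(Ψ_{j,i+1}) = [(x_i − x_{i+1})/(x_i − a_{i+1}x_{i+1})] Ψ_{j,i} + [(1 − a_{i+1})x_{i+1}/(x_i − a_{i+1}x_{i+1})] Ψ_{j,i+1}; and σ_i(Ψ_{j,k}) = Ψ_{j,k} for k ∉ {i, i+1}. -/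
/-- The exponent of `u_{j-1}`: `n_{j-1}`, with the convention `u_0 = q^0 = 1`. -/
def nprev {N : ℕ} (n : Fin N → ℤ) (j : Fin N) : ℤ :=
  if h : 0 < (j : ℕ) then n ⟨(j : ℕ) - 1, Nat.lt_of_le_of_lt (Nat.sub_le _ _) j.isLt⟩ else 0

/-- The exponent of `u_N = q^{n_N}` (the last coordinate). -/
def nlast {N : ℕ} (n : Fin N → ℤ) : ℤ :=
  if h : 0 < N then n ⟨N - 1, Nat.sub_lt h one_pos⟩ else 0

/-- `ν_j = γ_j − γ_{j+1}` with `γ_{N+1} = 0`. -/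
def nuOf {N : ℕ} (γ : Fin N → ℂ) (j : Fin N) : ℂ :=
  γ j - if h : (j : ℕ) + 1 < N then γ ⟨(j : ℕ) + 1, h⟩ else 0

/-- The integrand `Φ(n) = ∏_j u_j^{ν_j} (q u_j/u_{j−1};q)_∞/(b_j u_j/u_{j−1};q)_∞
· ∏_i (a_i x_i u_N;q)_∞/(x_i u_N;q)_∞` evaluated at `u_j = q^{n_j}`, with
`u_j^{ν_j} = exp(ν_j n_j Log q)`. -/
noncomputable def PhiInt (q : ℂ) {N M : ℕ} (γ b : Fin N → ℂ) (a x : Fin M → ℂ)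
    (n : Fin N → ℤ) : ℂ :=
  (∏ j : Fin N, Complex.exp (nuOf γ j * (n j : ℂ) * Complex.log q) *
      (qPochInf q (q ^ (n j - nprev n j + 1)) /
        qPochInf q (b j * q ^ (n j - nprev n j)))) *
  ∏ i : Fin M, qPochInf q (a i * x i * q ^ nlast n) / qPochInf q (x i * q ^ nlast n)

/-- `p_{j,i}(n) = (u_{j−1} − b_j u_j)/(1 − a_i x_i u_N) ·
∏_{k<i} (1 − x_k u_N)/(1 − a_k x_k u_N)` at `u_j = q^{n_j}`. -/
noncomputable def pInt (q : ℂ) {N M : ℕ} (b : Fin N → ℂ) (a x : Fin M → ℂ)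
    (j : Fin N) (i : Fin M) (n : Fin N → ℤ) : ℂ :=
  (q ^ nprev n j - b j * q ^ n j) / (1 - a i * x i * q ^ nlast n) *
  ∏ k ∈ Finset.Iio i, (1 - x k * q ^ nlast n) / (1 - a k * x k * q ^ nlast n)

/-- `Ψ_{j,i} = Σ_{n ∈ ℤ^N} Φ(n) p_{j,i}(n)` (bilateral Jackson sum). -/
noncomputable def PsiJI (q : ℂ) {N M : ℕ} (γ b : Fin N → ℂ) (a x : Fin M → ℂ)
    (j : Fin N) (i : Fin M) : ℂ :=
  ∑' n : Fin N → ℤ, PhiInt q γ b a x n * pInt q b a x j i n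

/-- `Φ` is symmetric under simultaneous permutations of the pairs `(a_i, x_i)`. -/
lemma PhiInt_comp_equiv (q : ℂ) {N M : ℕ} (γ b : Fin N → ℂ) (a x : Fin M → ℂ)
    (e : Equiv.Perm (Fin M)) (n : Fin N → ℤ) :
    PhiInt q γ b (a ∘ e) (x ∘ e) n = PhiInt q γ b a x n := by
  unfold PhiInt
  congr 1
  exact Equiv.prod_comp e
    (fun i => qPochInf q (a i * x i * q ^ nlast n) / qPochInf q (x i * q ^ nlast n))

/-- If `c` is not an integral power of `q`, then `1 - c q^m` does not vanish. -/
lemma one_sub_mul_zpow_ne_zero {q c : ℂ} (hc : ∀ m : ℤ, c ≠ q ^ m) (m : ℤ) :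
    1 - c * q ^ m ≠ 0 := by
  intro h
  apply hc (-m)
  rw [zpow_neg]
  exact eq_inv_of_mul_eq_one_left (sub_eq_zero.mp h).symm

/-- A product over an initial segment not separating `i` from its successor is unchanged by
swapping them. -/
lemma prod_Iio_swap {M : ℕ} {i i1 k : Fin M} (hi1 : (i1 : ℕ) = (i : ℕ) + 1) (hk : k ≠ i1)
    (f : Fin M → ℂ) :
    ∏ l ∈ Finset.Iio k, f (Equiv.swap i i1 l) = ∏ l ∈ Finset.Iio k, f l := by
  refine Finset.prod_equiv (Equiv.swap i i1) (fun l => ?_) (fun _ _ => rfl)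
  simp only [Finset.mem_Iio, Fin.lt_def]
  have hk' : (k : ℕ) ≠ i1 := fun h => hk (Fin.ext h)
  rcases eq_or_ne l i with rfl | h
  · rw [Equiv.swap_apply_left]; omega
  · rcases eq_or_ne l i1 with rfl | h1
    · rw [Equiv.swap_apply_right]; omega
    · rw [Equiv.swap_apply_of_ne_of_ne h h1]

lemma prod_Iio_succ {M : ℕ} {i i1 : Fin M} (hi1 : (i1 : ℕ) = (i : ℕ) + 1) (f : Fin M → ℂ) :
    ∏ l ∈ Finset.Iio i1, f l = f i * ∏ l ∈ Finset.Iio i, f l := by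
  have h : Finset.Iio i1 = insert i (Finset.Iio i) := by
    ext l
    simp only [Finset.mem_Iio, Finset.mem_insert, Fin.lt_def, Fin.ext_iff]
    omega
  rw [h, Finset.prod_insert (by simp)]

lemma exchange_first {a x a' x' u : ℂ} (h : 1 - a * x * u ≠ 0) (h' : 1 - a' * x' * u ≠ 0)
    (hd : x - a' * x' ≠ 0) :
    1 / (1 - a' * x' * u) =
      (1 - a) * x / (x - a' * x') * (1 / (1 - a * x * u)) +
      (a * x - a' * x') / (x - a' * x') *
        (1 / (1 - a' * x' * u) * ((1 - x * u) / (1 - a * x * u))) := by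
  generalize hA : 1 - a * x * u = A at *
  generalize hB : 1 - a' * x' * u = B at *
  generalize hD : x - a' * x' = D at *
  field_simp
  subst hA hB hD
  ring

lemma exchange_second {a x a' x' u : ℂ} (h : 1 - a * x * u ≠ 0) (h' : 1 - a' * x' * u ≠ 0)
    (hd : x - a' * x' ≠ 0) :
    1 / (1 - a * x * u) * ((1 - x' * u) / (1 - a' * x' * u)) =
      (x - x') / (x - a' * x') * (1 / (1 - a * x * u)) +
      (1 - a') * x' / (x - a' * x') *
        (1 / (1 - a' * x' * u) * ((1 - x * u) / (1 - a * x * u))) := by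
  generalize hA : 1 - a * x * u = A at *
  generalize hB : 1 - a' * x' * u = B at *
  generalize hD : x - a' * x' = D at *
  field_simp
  subst hA hB hD
  ring

/-- the action of the exchange operator
`σ_i : (a_i,x_i) ↔ (a_{i+1},x_{i+1})` on the functions `Ψ_{j,k}`:
`σ_i(Ψ_{j,i})` and `σ_i(Ψ_{j,i+1})` are explicit linear combinations of
`Ψ_{j,i}` and `Ψ_{j,i+1}`, and `σ_i(Ψ_{j,k}) = Ψ_{j,k}` for `k ∉ {i, i+1}`. -/
theorem stmt11 (N M : ℕ) (hN : 1 ≤ N) (hM : 1 ≤ M) (q : ℂ)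
    (hq0 : 0 < ‖q‖) (hq1 : ‖q‖ < 1)
    (a x : Fin M → ℂ) (b γ : Fin N → ℂ)
    (hb : ∀ j : Fin N, ∀ m : ℤ, b j ≠ q ^ m)
    (hx : ∀ i : Fin M, ∀ m : ℤ, x i ≠ q ^ m)
    (hax : ∀ i : Fin M, ∀ m : ℤ, a i * x i ≠ q ^ m)
    (i i1 : Fin M) (hi1 : (i1 : ℕ) = (i : ℕ) + 1)
    (hden : x i - a i1 * x i1 ≠ 0)
    (hsum : ∀ (j : Fin N) (k : Fin M),
      Summable (fun n : Fin N → ℤ => PhiInt q γ b a x n * pInt q b a x j k n))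
    (hsum' : ∀ (j : Fin N) (k : Fin M),
      Summable (fun n : Fin N → ℤ =>
        PhiInt q γ b (a ∘ Equiv.swap i i1) (x ∘ Equiv.swap i i1) n *
          pInt q b (a ∘ Equiv.swap i i1) (x ∘ Equiv.swap i i1) j k n)) :
    ∀ j : Fin N,
      (PsiJI q γ b (a ∘ Equiv.swap i i1) (x ∘ Equiv.swap i i1) j i =
        ((1 - a i) * x i / (x i - a i1 * x i1)) * PsiJI q γ b a x j i +
        ((a i * x i - a i1 * x i1) / (x i - a i1 * x i1)) * PsiJI q γ b a x j i1) ∧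
      (PsiJI q γ b (a ∘ Equiv.swap i i1) (x ∘ Equiv.swap i i1) j i1 =
        ((x i - x i1) / (x i - a i1 * x i1)) * PsiJI q γ b a x j i +
        ((1 - a i1) * x i1 / (x i - a i1 * x i1)) * PsiJI q γ b a x j i1) ∧
      ∀ k : Fin M, k ≠ i → k ≠ i1 →
        PsiJI q γ b (a ∘ Equiv.swap i i1) (x ∘ Equiv.swap i i1) j k =
          PsiJI q γ b a x j k := by
  intro j
  have hne : i ≠ i1 := fun h => by rw [h] at hi1; omega
  have hprod : ∀ (k : Fin M) (n : Fin N → ℤ), k ≠ i1 →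
      ∏ l ∈ Finset.Iio k, (1 - x (Equiv.swap i i1 l) * q ^ nlast n) /
        (1 - a (Equiv.swap i i1 l) * x (Equiv.swap i i1 l) * q ^ nlast n) =
      ∏ l ∈ Finset.Iio k, (1 - x l * q ^ nlast n) / (1 - a l * x l * q ^ nlast n) :=
    fun k n hk => prod_Iio_swap hi1 hk
      (fun l => (1 - x l * q ^ nlast n) / (1 - a l * x l * q ^ nlast n))
  refine ⟨?_, ?_, fun k hki hki1 => ?_⟩
  · unfold PsiJI
    rw [← tsum_mul_left, ← tsum_mul_left,
      ← ((hsum j i).mul_left _).tsum_add ((hsum j i1).mul_left _)]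
    refine tsum_congr fun n => ?_
    have h0 := one_sub_mul_zpow_ne_zero (hax i) (nlast n)
    have h1 := one_sub_mul_zpow_ne_zero (hax i1) (nlast n)
    rw [PhiInt_comp_equiv]
    simp only [pInt, Function.comp_apply, hprod i n hne, prod_Iio_succ hi1,
      Equiv.swap_apply_left]
    generalize PhiInt q γ b a x n = P
    generalize ∏ l ∈ Finset.Iio i, (1 - x l * q ^ nlast n) / (1 - a l * x l * q ^ nlast n) = R
    generalize q ^ nprev n j - b j * q ^ n j = S
    linear_combination P * S * R * exchange_first h0 h1 hden
  · unfold PsiJI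
    rw [← tsum_mul_left, ← tsum_mul_left,
      ← ((hsum j i).mul_left _).tsum_add ((hsum j i1).mul_left _)]
    refine tsum_congr fun n => ?_
    have h0 := one_sub_mul_zpow_ne_zero (hax i) (nlast n)
    have h1 := one_sub_mul_zpow_ne_zero (hax i1) (nlast n)
    rw [PhiInt_comp_equiv]
    simp only [pInt, Function.comp_apply, prod_Iio_succ hi1, hprod i n hne,
      Equiv.swap_apply_left, Equiv.swap_apply_right]
    generalize PhiInt q γ b a x n = P
    generalize ∏ l ∈ Finset.Iio i, (1 - x l * q ^ nlast n) / (1 - a l * x l * q ^ nlast n) = R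
    generalize q ^ nprev n j - b j * q ^ n j = S
    linear_combination P * S * R * exchange_second h0 h1 hden
  · unfold PsiJI
    refine tsum_congr fun n => ?_
    rw [PhiInt_comp_equiv]
    simp only [pInt, Function.comp_apply, hprod k n hki1,
      Equiv.swap_apply_of_ne_of_ne hki hki1]
end
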